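/- arXiv:1506.04856 — 2 statements merged into one kernel-verified Lean document; each statement's English description precedes it below -/
import Mathlib

section
/- Let d ≥ 1, p > 0 and −∞ < β < α < ∞. The domain of the upsilon transform 𝔗_{β→α,p} is: 𝔐^0 (all Lévy measures on ℝ^d) if α < 0; 𝔐^log if α = 0; 𝔐^α if α ∈ (0,2); and {0} (only the zero measure) if α ≥ 2. In particular 𝔇(𝔗_{β→α,p}) = 𝔇(Ψ_{α,p}). -/
open MeasureTheory Set

noncomputable section

variable {E : Type*} [NormedAddCommGroup E] [NormedSpace ℝ E]
  [MeasurableSpace E] [BorelSpace E]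

/-- The upsilon transform with dilation measure `ρ` on `(0,∞) ⊆ ℝ`:
`[Υ_ρ M](B) = ∫ M(s⁻¹ B) ρ(ds)`, realized as the image of `ρ ⊗ M` under `(s, x) ↦ s • x`. -/
def Upsilon (ρ : Measure ℝ) (M : Measure E) : Measure E :=
  Measure.map (fun sx : ℝ × E => sx.1 • sx.2) (ρ.prod M)

/-- `M` is a Lévy measure: σ-finite, no mass at `0`, and `∫ (|x|² ∧ 1) M(dx) < ∞`. -/
def IsLevyMeasure (M : Measure E) : Prop :=
  SigmaFinite M ∧ M {0} = 0 ∧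
    ∫⁻ x, ENNReal.ofReal (min (‖x‖ ^ 2) 1) ∂M < ⊤

/-- The domain `𝔇(Υ_ρ)`: Lévy measures `M` such that `Υ_ρ M` is again a Lévy measure. -/
def UpsilonDomain (ρ : Measure ℝ) : Set (Measure E) :=
  {M | IsLevyMeasure M ∧ IsLevyMeasure (Upsilon ρ M)}

/-- The range `ℜ(Υ_ρ) = {Υ_ρ M : M ∈ 𝔇(Υ_ρ)}`. -/
def UpsilonRange (ρ : Measure ℝ) : Set (Measure E) :=
  Upsilon ρ '' UpsilonDomain (E := E) ρ

/-- The class `𝔐^α`: Borel measures with `M({0}) = 0` and `∫ (|x|² ∧ |x|^α) M(dx) < ∞`. -/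
def MemMAlpha (α : ℝ) (M : Measure E) : Prop :=
  M {0} = 0 ∧ ∫⁻ x, ENNReal.ofReal (min (‖x‖ ^ 2) (‖x‖ ^ α)) ∂M < ⊤

/-- The class `𝔐^log`: Lévy measures with `∫_{|x|>1} log|x| M(dx) < ∞`. -/
def MemMLog (M : Measure E) : Prop :=
  IsLevyMeasure M ∧
    ∫⁻ x in {x : E | 1 < ‖x‖}, ENNReal.ofReal (Real.log ‖x‖) ∂M < ⊤

/-- The dilation measure `ψ_{α,p}(ds) = s^{-α-1} e^{-s^p} 1_{s>0} ds`. -/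
def psiMeasure (α p : ℝ) : Measure ℝ :=
  (volume : Measure ℝ).withDensity fun s =>
    if 0 < s then ENNReal.ofReal (s ^ (-α - 1) * Real.exp (-(s ^ p))) else 0

/-- `K_{α,β,p} = ∫₀^∞ u^{α-β-1} e^{-u^p} du`. -/
def Kconst (α β p : ℝ) : ℝ :=
  ∫ u in Ioi (0 : ℝ), u ^ (α - β - 1) * Real.exp (-(u ^ p))

/-- The dilation measure
`τ_{β→α,p}(ds) = K_{α,β,p}⁻¹ s^{-α-1} (1-s^p)^{(α-β)/p - 1} 1_{0<s<1} ds`. -/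
def tauMeasure (β α p : ℝ) : Measure ℝ :=
  (volume : Measure ℝ).withDensity fun s =>
    if 0 < s ∧ s < 1 then
      ENNReal.ofReal ((Kconst α β p)⁻¹ * (s ^ (-α - 1) * (1 - s ^ p) ^ ((α - β) / p - 1)))
    else 0

/-- `f` is the density of the fully right-skewed `r`-stable distribution on `(0,∞)`:
a nonnegative measurable function with `∫₀^∞ e^{-t x} f(x) dx = e^{-t^r}` for all `t ≥ 0`. -/
def IsStableDensity (r : ℝ) (f : ℝ → ℝ) : Prop :=
  Measurable f ∧ (∀ x, 0 ≤ f x) ∧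
    ∀ t : ℝ, 0 ≤ t →
      ∫ x in Ioi (0 : ℝ), Real.exp (-(t * x)) * f x = Real.exp (-(t ^ r))

/-- The dilation measure `π_{α,p→q}(ds) = p f_{q/p}(s^{-p}) s^{-α-p-1} 1_{s>0} ds`,
where `f` is (to be assumed) the density of the fully right-skewed `q/p`-stable law. -/
def piMeasure (f : ℝ → ℝ) (α p : ℝ) : Measure ℝ :=
  (volume : Measure ℝ).withDensity fun s =>
    if 0 < s then ENNReal.ofReal (p * f (s ^ (-p)) * s ^ (-α - p - 1)) else 0

/-- The measure `ρ(ds) = g(s) 1_{s>0} ds`. -/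
def densMeasure (g : ℝ → ℝ) : Measure ℝ :=
  (volume : Measure ℝ).withDensity fun s => if 0 < s then ENNReal.ofReal (g s) else 0

open scoped ENNReal

lemma lintegral_Ioo_zero_rpow {q m : ℝ} (hq : -1 < q) (hm : 0 < m) :
    ∫⁻ s in Ioo 0 m, ENNReal.ofReal (s ^ q) = ENNReal.ofReal (m ^ (q + 1) / (q + 1)) := by
  rw [← ofReal_integral_eq_lintegral_ofReal
    ((intervalIntegral.integrableOn_Ioo_rpow_iff hm).2 hq), ← integral_Ioc_eq_integral_Ioo,
    ← intervalIntegral.integral_of_le hm.le, integral_rpow (Or.inl hq),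
    Real.zero_rpow (by linarith), sub_zero]
  filter_upwards [ae_restrict_mem measurableSet_Ioo] with s hs
  exact Real.rpow_nonneg hs.1.le _

lemma lintegral_Ioo_zero_rpow_eq_top {q m : ℝ} (hq : q ≤ -1) (hm : 0 < m) :
    ∫⁻ s in Ioo 0 m, ENNReal.ofReal (s ^ q) = ⊤ := by
  by_contra h
  have hi := (lintegral_ofReal_ne_top_iff_integrable
    (by fun_prop : Measurable fun s : ℝ => s ^ q).aestronglyMeasurable (by
      filter_upwards [ae_restrict_mem measurableSet_Ioo] with s hs
      exact Real.rpow_nonneg hs.1.le _)).1 h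
  have := (intervalIntegral.integrableOn_Ioo_rpow_iff hm).1 hi
  linarith

lemma lintegral_Ioi_rpow {q m : ℝ} (hq : q < -1) (hm : 0 < m) :
    ∫⁻ s in Ioi m, ENNReal.ofReal (s ^ q) = ENNReal.ofReal (-m ^ (q + 1) / (q + 1)) := by
  rw [← ofReal_integral_eq_lintegral_ofReal (integrableOn_Ioi_rpow_of_lt hq hm),
    integral_Ioi_rpow_of_lt hq hm]
  filter_upwards [ae_restrict_mem measurableSet_Ioi] with s hs
  exact Real.rpow_nonneg (hm.trans hs).le _

lemma lintegral_Ioc_inv {a b : ℝ} (ha : 0 < a) (hab : a ≤ b) :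
    ∫⁻ s in Ioc a b, ENNReal.ofReal s⁻¹ = ENNReal.ofReal (Real.log (b / a)) := by
  have hi : IntervalIntegrable (fun s : ℝ => s⁻¹) volume a b := by
    refine intervalIntegral.intervalIntegrable_inv (fun x hx => ?_) continuousOn_id
    rw [uIcc_of_le hab] at hx
    exact (ha.trans_le hx.1).ne'
  rw [← ofReal_integral_eq_lintegral_ofReal
      ((intervalIntegrable_iff_integrableOn_Ioc_of_le hab).1 hi),
    ← intervalIntegral.integral_of_le hab, integral_inv_of_pos ha (ha.trans_le hab)]
  filter_upwards [ae_restrict_mem measurableSet_Ioc] with s hs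
  exact inv_nonneg.2 (ha.trans hs.1).le

/-- The integral of `s ↦ (s r)² ∧ 1` against `s^{-α-1} ds` on `(0,1/2)`. -/
def powerTruncMoment (α r : ℝ) : ℝ≥0∞ :=
  ∫⁻ s in Ioo (0 : ℝ) (1 / 2), ENNReal.ofReal (s ^ (-α - 1) * min ((s * r) ^ 2) 1)

lemma rpow_mul_sq {α r s : ℝ} (hs : 0 < s) :
    s ^ (-α - 1) * (s * r) ^ 2 = r ^ 2 * s ^ (1 - α) := by
  have : s ^ (1 - α) = s ^ (-α - 1) * s ^ 2 := by
    rw [← Real.rpow_natCast, ← Real.rpow_add hs]; congr 1; push_cast; ring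
  rw [this]; ring

lemma sq_mul_lintegral_le_powerTruncMoment {α r m : ℝ} (hr : 0 ≤ r) (hm : m ≤ 1 / 2)
    (hmr : m * r ≤ 1) :
    ENNReal.ofReal (r ^ 2) * ∫⁻ s in Ioo 0 m, ENNReal.ofReal (s ^ (1 - α)) ≤
      powerTruncMoment α r := by
  rw [← lintegral_const_mul _ (by fun_prop)]
  refine (setLIntegral_mono' measurableSet_Ioo fun s hs => ?_).trans
    (lintegral_mono_set (Ioo_subset_Ioo_right hm))
  rw [← ENNReal.ofReal_mul (by positivity), min_eq_left, rpow_mul_sq hs.1]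
  have h0 : 0 ≤ s * r := mul_nonneg hs.1.le hr
  have h1 : s * r ≤ 1 := (mul_le_mul_of_nonneg_right hs.2.le hr).trans hmr
  nlinarith

lemma setLIntegral_le_sq_mul_lintegral {α r m : ℝ} :
    ∫⁻ s in Ioo 0 m, ENNReal.ofReal (s ^ (-α - 1) * min ((s * r) ^ 2) 1) ≤
      ENNReal.ofReal (r ^ 2) * ∫⁻ s in Ioo 0 m, ENNReal.ofReal (s ^ (1 - α)) := by
  rw [← lintegral_const_mul _ (by fun_prop)]
  refine setLIntegral_mono' measurableSet_Ioo fun s hs => ?_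
  rw [← ENNReal.ofReal_mul (by positivity), ← rpow_mul_sq hs.1]
  gcongr
  · exact Real.rpow_nonneg hs.1.le _
  · exact min_le_left _ _

lemma powerTruncMoment_le_of_neg {α r : ℝ} (hα : α < 0) :
    powerTruncMoment α r ≤
      ENNReal.ofReal ((1 / 2) ^ (-α) / (-α)) * ENNReal.ofReal (min (r ^ 2) 1) := by
  have hI := lintegral_Ioo_zero_rpow (q := -α - 1) (m := 1 / 2) (by linarith) (by norm_num)
  rw [sub_add_cancel] at hI
  rw [← hI, ← lintegral_mul_const _ (by fun_prop)]
  refine setLIntegral_mono' measurableSet_Ioo fun s hs => ?_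
  have hp := Real.rpow_nonneg hs.1.le (-α - 1)
  rw [← ENNReal.ofReal_mul hp]
  refine ENNReal.ofReal_le_ofReal (mul_le_mul_of_nonneg_left (min_le_min_right _ ?_) hp)
  rw [mul_pow]
  have : s ^ 2 ≤ 1 := by nlinarith [hs.1, hs.2]
  nlinarith [sq_nonneg r]

lemma powerTruncMoment_zero_le {r : ℝ} (hr : 0 ≤ r) :
    powerTruncMoment 0 r ≤ ENNReal.ofReal (min (r ^ 2) 1) +
      (if 1 < r then ENNReal.ofReal (Real.log r) else 0) := by
  split_ifs with h1
  · have hr0 : 0 < r := by linarith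
    have hsub : Ioo (0 : ℝ) (1 / 2) ⊆ Ioo 0 (1 / r) ∪ (Ioc (1 / r) 1 ∪ {1 / r}) := by
      intro s hs
      rcases lt_trichotomy s (1 / r) with h | h | h
      · exact Or.inl ⟨hs.1, h⟩
      · exact Or.inr (Or.inr h)
      · exact Or.inr (Or.inl ⟨h, by linarith [hs.2]⟩)
    refine (lintegral_mono_set hsub).trans ((lintegral_union_le _ _ _).trans
      (add_le_add ?_ ((lintegral_union_le _ _ _).trans ?_)))
    · refine setLIntegral_le_sq_mul_lintegral.trans ?_
      rw [lintegral_Ioo_zero_rpow (by norm_num) (by positivity),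
        ← ENNReal.ofReal_mul (by positivity), min_eq_right (by nlinarith)]
      apply ENNReal.ofReal_le_ofReal
      norm_num
      field_simp
      norm_num
    · rw [Measure.restrict_singleton, measure_singleton, zero_smul, lintegral_zero_measure,
        add_zero]
      have hI := lintegral_Ioc_inv (a := 1 / r) (b := 1) (by positivity)
        (by rw [div_le_one hr0]; exact h1.le)
      rw [one_div_one_div] at hI
      rw [← hI]
      refine setLIntegral_mono' measurableSet_Ioc fun s hs => ?_
      have hs0 : 0 < s := lt_trans (by positivity) hs.1
      gcongr
      rw [show (-0 - 1 : ℝ) = -1 by norm_num, Real.rpow_neg_one]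
      exact mul_le_of_le_one_right (inv_nonneg.2 hs0.le) (min_le_right _ _)
  · rw [add_zero, min_eq_left (by nlinarith)]
    refine setLIntegral_le_sq_mul_lintegral.trans ?_
    rw [lintegral_Ioo_zero_rpow (by norm_num) (by positivity),
        ← ENNReal.ofReal_mul (by positivity)]
    apply ENNReal.ofReal_le_ofReal
    norm_num
    nlinarith [sq_nonneg r]

lemma log_le_powerTruncMoment_zero {r : ℝ} (hr : 1 < r) :
    ENNReal.ofReal (Real.log r) ≤ ENNReal.ofReal (min (r ^ 2) 1) + powerTruncMoment 0 r := by
  have hr0 : 0 < r := by linarith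
  rw [min_eq_right (by nlinarith)]
  by_cases h2 : r ≤ 2
  · refine le_add_right (ENNReal.ofReal_le_ofReal ?_)
    have := Real.log_le_sub_one_of_pos hr0
    linarith
  · push Not at h2
    have hle : 1 / r ≤ 1 / 2 := one_div_le_one_div_of_le (by norm_num) h2.le
    have hI := lintegral_Ioc_inv (a := 1 / r) (b := 1 / 2) (by positivity) hle
    rw [show (1 / 2 : ℝ) / (1 / r) = r / 2 by field_simp, Real.log_div hr0.ne' (by norm_num)] at hI
    have hH : ENNReal.ofReal (Real.log r - Real.log 2) ≤ powerTruncMoment 0 r := by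
      rw [← hI, setLIntegral_congr Ioo_ae_eq_Ioc.symm]
      refine (setLIntegral_mono' measurableSet_Ioo fun s hs => ?_).trans
        (lintegral_mono_set (Ioo_subset_Ioo_left (by positivity)))
      have h1 : 1 ≤ s * r := by
        have := hs.1; rw [div_lt_iff₀ hr0] at this; exact this.le
      rw [min_eq_right (by nlinarith), mul_one, show (-0 - 1 : ℝ) = -1 by norm_num,
        Real.rpow_neg_one]
    refine le_trans ?_ (add_le_add_right hH _)
    have := Real.log_two_lt_d9
    have h3 : 0 ≤ Real.log r - Real.log 2 := sub_nonneg.2 (Real.log_le_log (by norm_num) h2.le)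
    rw [← ENNReal.ofReal_add (by norm_num) h3]
    apply ENNReal.ofReal_le_ofReal
    linarith

lemma min_one_le_min_rpow {α r : ℝ} (hα0 : 0 < α) (hα2 : α < 2) (hr : 0 ≤ r) :
    min (r ^ 2) 1 ≤ min (r ^ 2) (r ^ α) := by
  refine le_min (min_le_left _ _) ?_
  rcases le_total r 1 with h | h
  · refine (min_le_left _ _).trans ?_
    rcases hr.eq_or_lt with rfl | h0
    · simp [Real.zero_rpow hα0.ne']
    · rw [← Real.rpow_natCast]
      exact Real.rpow_le_rpow_of_exponent_ge h0 h (by push_cast; linarith)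
  · exact (min_le_right _ _).trans (Real.one_le_rpow h hα0.le)

lemma exists_powerTruncMoment_le {α : ℝ} (hα0 : 0 < α) (hα2 : α < 2) :
    ∃ C : ℝ, ∀ r : ℝ, 0 ≤ r → powerTruncMoment α r ≤
      ENNReal.ofReal C * ENNReal.ofReal (min (r ^ 2) (r ^ α)) := by
  set A : ℝ := (1 / 2) ^ (2 - α) / (2 - α)
  set B : ℝ := 1 / (2 - α) + 1 / α
  have h2α : 0 < 2 - α := by linarith
  have hA : 0 ≤ A := by positivity
  have hB : 0 ≤ B := by positivity
  refine ⟨max A B, fun r hr => ?_⟩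
  rw [← ENNReal.ofReal_mul (hA.trans (le_max_left _ _))]
  have h1 : powerTruncMoment α r ≤ ENNReal.ofReal (A * r ^ 2) := by
    refine setLIntegral_le_sq_mul_lintegral.trans ?_
    rw [lintegral_Ioo_zero_rpow (by linarith) (by positivity),
      ← ENNReal.ofReal_mul (by positivity), mul_comm, show 1 - α + 1 = 2 - α by ring]
  rcases hr.eq_or_lt with rfl | hr0
  · refine h1.trans (ENNReal.ofReal_le_ofReal ?_)
    simp [Real.zero_rpow hα0.ne']
  have h2 : powerTruncMoment α r ≤ ENNReal.ofReal (B * r ^ α) := by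
    have hsub : Ioo (0 : ℝ) (1 / 2) ⊆ Ioo 0 r⁻¹ ∪ (Ioi r⁻¹ ∪ {r⁻¹}) := by
      intro s hs
      rcases lt_trichotomy s r⁻¹ with h | h | h
      · exact Or.inl ⟨hs.1, h⟩
      · exact Or.inr (Or.inr h)
      · exact Or.inr (Or.inl h)
    have hBr : B * r ^ α = r ^ 2 * (r⁻¹ ^ (1 - α + 1) / (1 - α + 1)) +
        -r⁻¹ ^ (-α - 1 + 1) / (-α - 1 + 1) := by
      rw [show 1 - α + 1 = 2 - α by ring, sub_add_cancel, Real.inv_rpow hr, Real.inv_rpow hr,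
        Real.rpow_sub hr0, Real.rpow_neg hr, Real.rpow_two]
      simp only [B]
      field_simp
    rw [hBr, ENNReal.ofReal_add (by rw [show 1 - α + 1 = 2 - α by ring]; positivity) (by
      rw [sub_add_cancel, neg_div_neg_eq]; positivity)]
    refine (lintegral_mono_set hsub).trans ((lintegral_union_le _ _ _).trans
      (add_le_add ?_ ((lintegral_union_le _ _ _).trans ?_)))
    · refine setLIntegral_le_sq_mul_lintegral.trans ?_
      rw [lintegral_Ioo_zero_rpow (by linarith) (by positivity),
        ← ENNReal.ofReal_mul (by positivity)]
    · rw [Measure.restrict_singleton, measure_singleton, zero_smul, lintegral_zero_measure,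
        add_zero, ← lintegral_Ioi_rpow (by linarith) (by positivity)]
      refine setLIntegral_mono' measurableSet_Ioi fun s hs => ?_
      have hs0 : 0 < s := lt_trans (by positivity) hs
      gcongr
      exact mul_le_of_le_one_right (by positivity) (min_le_right _ _)
  have hra : 0 ≤ r ^ α := by positivity
  rcases min_choice (r ^ 2) (r ^ α) with h | h <;> rw [h]
  · refine h1.trans (ENNReal.ofReal_le_ofReal ?_)
    gcongr; exact le_max_left _ _
  · refine h2.trans (ENNReal.ofReal_le_ofReal ?_)
    gcongr; exact le_max_right _ _

lemma le_powerTruncMoment {α : ℝ} (hα2 : α < 2) {r : ℝ} (hr : 0 < r) :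
    ENNReal.ofReal ((1 / 2) ^ (2 - α) / (2 - α)) * ENNReal.ofReal (min (r ^ 2) (r ^ α)) ≤
      powerTruncMoment α r := by
  have h2α : 0 < 2 - α := by linarith
  rcases le_total r 1 with h | h
  · refine le_trans ?_ (sq_mul_lintegral_le_powerTruncMoment (m := 1 / 2) hr.le le_rfl
      (by linarith))
    rw [lintegral_Ioo_zero_rpow (by linarith) (by positivity), mul_comm,
      show 1 - α + 1 = 2 - α by ring]
    gcongr
    exact min_le_left _ _
  · have hle : r⁻¹ ≤ 1 := inv_le_one_of_one_le₀ h
    refine le_trans ?_ (sq_mul_lintegral_le_powerTruncMoment (m := 1 / 2 * r⁻¹) hr.le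
      (by linarith) (by field_simp; norm_num))
    rw [lintegral_Ioo_zero_rpow (by linarith) (by positivity),
      show 1 - α + 1 = 2 - α by ring, ← ENNReal.ofReal_mul (by positivity),
      ← ENNReal.ofReal_mul (by positivity)]
    apply ENNReal.ofReal_le_ofReal
    have : r ^ 2 * ((1 / 2 * r⁻¹) ^ (2 - α) / (2 - α)) =
        (1 / 2) ^ (2 - α) / (2 - α) * r ^ α := by
      rw [Real.mul_rpow (by norm_num) (by positivity), Real.inv_rpow hr.le, Real.rpow_sub hr,
        Real.rpow_two]
      field_simp
    rw [this]
    gcongr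
    exact min_le_right _ _

lemma powerTruncMoment_eq_top {α r : ℝ} (hα : 2 ≤ α) (hr : 0 < r) :
    powerTruncMoment α r = ⊤ := by
  have h0 : 0 < min (1 / 2) r⁻¹ := lt_min (by norm_num) (by positivity)
  have h := sq_mul_lintegral_le_powerTruncMoment (α := α) (m := min (1 / 2) r⁻¹) hr.le
    (min_le_left _ _) ((mul_le_mul_of_nonneg_right (min_le_right _ _) hr.le).trans
      (inv_mul_cancel₀ hr.ne').le)
  rw [lintegral_Ioo_zero_rpow_eq_top (by linarith) h0, ENNReal.mul_top
    (by simpa using hr.ne')] at h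
  exact top_le_iff.1 h

/-- A dilation density which is comparable to `s^{-α-1}` near `0` and has a finite second moment
at infinity. -/
structure IsPowerDensity (α : ℝ) (g : ℝ → ℝ≥0∞) : Prop where
  measurable : Measurable g
  ne_top : ∀ s, g s ≠ ⊤
  eq_zero : ∀ s ≤ 0, g s = 0
  lower : ∃ c : ℝ, 0 < c ∧ ∀ s ∈ Ioo (0 : ℝ) (1 / 2), ENNReal.ofReal (c * s ^ (-α - 1)) ≤ g s
  upper : ∃ C : ℝ, 0 ≤ C ∧ ∀ s ∈ Ioo (0 : ℝ) (1 / 2), g s ≤ ENNReal.ofReal (C * s ^ (-α - 1))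
  tail : ∫⁻ s in Ici (1 / 2 : ℝ), g s * ENNReal.ofReal (s ^ 2) < ⊤

/-- The integral of `s ↦ (s r)² ∧ 1` against `g(s) ds`. -/
def truncMoment (g : ℝ → ℝ≥0∞) (r : ℝ) : ℝ≥0∞ :=
  ∫⁻ s, g s * ENNReal.ofReal (min ((s * r) ^ 2) 1)

namespace IsPowerDensity

variable {α : ℝ} {g : ℝ → ℝ≥0∞}

lemma exists_le_truncMoment (hg : IsPowerDensity α g) :
    ∃ c : ℝ, 0 < c ∧ ∀ r, ENNReal.ofReal c * powerTruncMoment α r ≤ truncMoment g r := by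
  obtain ⟨c, hc, h⟩ := hg.lower
  refine ⟨c, hc, fun r => ?_⟩
  rw [powerTruncMoment, ← lintegral_const_mul _ (by fun_prop)]
  refine (setLIntegral_mono' measurableSet_Ioo fun s hs => ?_).trans
    (setLIntegral_le_lintegral (Ioo 0 (1 / 2)) _)
  have hp := Real.rpow_nonneg hs.1.le (-α - 1)
  rw [← ENNReal.ofReal_mul hc.le, ← mul_assoc, ENNReal.ofReal_mul (by positivity)]
  gcongr
  exact h s hs

lemma exists_truncMoment_le (hg : IsPowerDensity α g) :
    ∃ C T : ℝ≥0∞, C ≠ ⊤ ∧ T ≠ ⊤ ∧ ∀ r, truncMoment g r ≤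
      C * powerTruncMoment α r + T * ENNReal.ofReal (min (r ^ 2) 1) := by
  obtain ⟨C, hC, h⟩ := hg.upper
  refine ⟨ENNReal.ofReal C, (∫⁻ s in Ici (1 / 2 : ℝ), g s * ENNReal.ofReal (s ^ 2)) * 4,
    ENNReal.ofReal_ne_top, ENNReal.mul_ne_top hg.tail.ne (by norm_num), fun r => ?_⟩
  have hcover : (univ : Set ℝ) ⊆ Iic 0 ∪ (Ioo 0 (1 / 2) ∪ Ici (1 / 2)) := by
    intro s _
    rcases le_or_gt s 0 with h0 | h0
    · exact Or.inl h0
    · rcases lt_or_ge s (1 / 2) with h1 | h1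
      · exact Or.inr (Or.inl ⟨h0, h1⟩)
      · exact Or.inr (Or.inr h1)
  have hz : ∫⁻ s in Iic (0 : ℝ), g s * ENNReal.ofReal (min ((s * r) ^ 2) 1) = 0 := by
    rw [setLIntegral_congr_fun measurableSet_Iic (g := fun _ => 0)
      (fun s hs => by simp [hg.eq_zero s hs])]
    simp
  rw [truncMoment, ← setLIntegral_univ]
  refine (lintegral_mono_set hcover).trans ((lintegral_union_le _ _ _).trans ?_)
  rw [hz, zero_add]
  refine (lintegral_union_le _ _ _).trans (add_le_add ?_ ?_)
  · rw [powerTruncMoment, ← lintegral_const_mul _ (by fun_prop)]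
    refine setLIntegral_mono' measurableSet_Ioo fun s hs => ?_
    have hp := Real.rpow_nonneg hs.1.le (-α - 1)
    rw [← ENNReal.ofReal_mul hC, ← mul_assoc, ENNReal.ofReal_mul (by positivity)]
    gcongr
    exact h s hs
  · have hm := hg.measurable
    rw [mul_assoc, ← lintegral_mul_const _ (by fun_prop)]
    refine setLIntegral_mono' measurableSet_Ici fun s hs => ?_
    rw [mul_assoc, ← ENNReal.ofReal_ofNat, ← ENNReal.ofReal_mul (by norm_num),
      ← ENNReal.ofReal_mul (by positivity)]
    gcongr
    have hs1 : 1 ≤ s ^ 2 * 4 := by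
      have : (1 / 2 : ℝ) ≤ s := hs
      nlinarith
    rw [mul_pow]
    rcases min_choice (r ^ 2) 1 with h | h <;> rw [h]
    · exact (min_le_left _ _).trans (by nlinarith [mul_nonneg (sq_nonneg s) (sq_nonneg r)])
    · exact (min_le_right _ _).trans (by nlinarith)

end IsPowerDensity

lemma sigmaFinite_of_lintegral_ne_top {X : Type*} [MeasurableSpace X] {μ : Measure X}
    {f : X → ℝ≥0∞} (hf : Measurable f) (h0 : ∀ᵐ x ∂μ, f x ≠ 0) (hi : ∫⁻ x, f x ∂μ ≠ ⊤) :
    SigmaFinite μ := by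
  have htop : ∀ᵐ x ∂μ, f x ≠ ⊤ := (ae_lt_top hf hi).mono fun x hx => hx.ne
  have := isFiniteMeasure_withDensity hi
  rw [← withDensity_inv_same hf h0 htop]
  exact SigmaFinite.withDensity_of_ne_top
    ((withDensity_absolutelyContinuous μ f).ae_le (h0.mono fun x hx => ENNReal.inv_ne_top.2 hx))

lemma isLevyMeasure_iff {F : Type*} [NormedAddCommGroup F] [MeasurableSpace F] [BorelSpace F]
    {M : Measure F} :
    IsLevyMeasure M ↔ M {0} = 0 ∧ ∫⁻ x, ENNReal.ofReal (min (‖x‖ ^ 2) 1) ∂M < ⊤ := by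
  refine ⟨fun h => h.2, fun h => ⟨?_, h⟩⟩
  refine sigmaFinite_of_lintegral_ne_top (by fun_prop) ?_ h.2.ne
  filter_upwards [measure_eq_zero_iff_ae_notMem.1 h.1] with x hx
  have : 0 < ‖x‖ := norm_pos_iff.2 hx
  exact (ENNReal.ofReal_pos.2 (lt_min (by positivity) one_pos)).ne'

lemma upsilon_isLevyMeasure_iff [SecondCountableTopology E] {α : ℝ} {g : ℝ → ℝ≥0∞}
    (hg : IsPowerDensity α g) {M : Measure E} [SigmaFinite M] (hM : M {0} = 0) :
    IsLevyMeasure (Upsilon (volume.withDensity g) M) ↔ ∫⁻ x, truncMoment g ‖x‖ ∂M < ⊤ := by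
  have hm := hg.measurable
  have : SigmaFinite ((volume : Measure ℝ).withDensity g) :=
    SigmaFinite.withDensity_of_ne_top (Filter.Eventually.of_forall hg.ne_top)
  have hsm : Measurable fun sx : ℝ × E => sx.1 • sx.2 := by fun_prop
  have hzero : Upsilon (volume.withDensity g) M {0} = 0 := by
    rw [Upsilon, Measure.map_apply hsm (measurableSet_singleton 0)]
    have hsub : (fun sx : ℝ × E => sx.1 • sx.2) ⁻¹' {0} ⊆
        (Iic 0 ×ˢ univ) ∪ (univ ×ˢ {0}) := by
      rintro ⟨s, x⟩ h
      rcases smul_eq_zero.1 (show s • x = 0 from h) with h | h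
      · exact Or.inl ⟨h.le, mem_univ _⟩
      · exact Or.inr ⟨mem_univ _, h⟩
    refine measure_mono_null hsub (measure_union_null ?_ ?_)
    · rw [Measure.prod_prod, withDensity_apply _ measurableSet_Iic,
        setLIntegral_congr_fun measurableSet_Iic (g := fun _ => 0) hg.eq_zero]
      simp
    · rw [Measure.prod_prod, hM, mul_zero]
  have hint : ∫⁻ x, ENNReal.ofReal (min (‖x‖ ^ 2) 1) ∂(Upsilon (volume.withDensity g) M) =
      ∫⁻ x, truncMoment g ‖x‖ ∂M := by
    rw [Upsilon, lintegral_map (by fun_prop) hsm, lintegral_prod_symm _ (by fun_prop)]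
    refine lintegral_congr fun x => ?_
    rw [lintegral_withDensity_eq_lintegral_mul _ hm (by fun_prop)]
    refine lintegral_congr fun s => ?_
    simp [norm_smul, mul_pow]
  rw [isLevyMeasure_iff, hint]
  exact and_iff_right hzero

lemma mem_upsilonDomain_iff [SecondCountableTopology E] {α : ℝ} {g : ℝ → ℝ≥0∞}
    (hg : IsPowerDensity α g) {M : Measure E} :
    M ∈ UpsilonDomain (volume.withDensity g) ↔
      IsLevyMeasure M ∧ ∫⁻ x, truncMoment g ‖x‖ ∂M < ⊤ := by
  refine and_congr_right fun h => ?_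
  have := h.1
  exact upsilon_isLevyMeasure_iff hg h.2.1

lemma lintegral_lt_top_of_le {X : Type*} [MeasurableSpace X] {μ : Measure X} {f u v : X → ℝ≥0∞}
    {a b : ℝ≥0∞} (hu : Measurable u) (hv : Measurable v) (ha : a ≠ ⊤) (hb : b ≠ ⊤)
    (hui : ∫⁻ x, u x ∂μ < ⊤) (hvi : ∫⁻ x, v x ∂μ < ⊤)
    (h : ∀ᵐ x ∂μ, f x ≤ a * u x + b * v x) : ∫⁻ x, f x ∂μ < ⊤ := by
  refine (lintegral_mono_ae h).trans_lt ?_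
  rw [lintegral_add_left (by fun_prop), lintegral_const_mul _ hu, lintegral_const_mul _ hv]
  exact ENNReal.add_lt_top.2 ⟨ENNReal.mul_lt_top ha.lt_top hui, ENNReal.mul_lt_top hb.lt_top hvi⟩

namespace IsPowerDensity

variable [SecondCountableTopology E] {α : ℝ} {g : ℝ → ℝ≥0∞}

lemma upsilonDomain_of_neg (hg : IsPowerDensity α g) (hα : α < 0) :
    UpsilonDomain (E := E) (volume.withDensity g) = {M | IsLevyMeasure M} := by
  ext M
  rw [mem_upsilonDomain_iff hg]
  refine and_iff_left_of_imp fun hM => ?_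
  obtain ⟨C, T, hC, hT, h⟩ := hg.exists_truncMoment_le
  refine lintegral_lt_top_of_le (by fun_prop) (by fun_prop)
    (ENNReal.mul_ne_top hC (ENNReal.ofReal_ne_top (r := (1 / 2) ^ (-α) / (-α)))) hT hM.2.2 hM.2.2
    (Filter.Eventually.of_forall fun x => (h ‖x‖).trans (add_le_add_left ?_ _))
  rw [mul_assoc]
  gcongr
  exact powerTruncMoment_le_of_neg hα

lemma upsilonDomain_zero (hg : IsPowerDensity 0 g) :
    UpsilonDomain (E := E) (volume.withDensity g) = {M | MemMLog M} := by
  ext M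
  rw [mem_upsilonDomain_iff hg]
  refine and_congr_right fun hM => ?_
  have hset : MeasurableSet {x : E | 1 < ‖x‖} := measurableSet_lt (by fun_prop) (by fun_prop)
  rw [← lintegral_indicator hset]
  have hml : Measurable ({x : E | 1 < ‖x‖}.indicator fun x => ENNReal.ofReal (Real.log ‖x‖)) :=
    Measurable.indicator (by fun_prop) hset
  obtain ⟨C, T, hC, hT, h⟩ := hg.exists_truncMoment_le
  obtain ⟨c, hc, hlow⟩ := hg.exists_le_truncMoment
  constructor
  · intro hi
    have hcm : ∀ r, powerTruncMoment 0 r ≤ (ENNReal.ofReal c)⁻¹ * truncMoment g r := fun r => by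
      rw [mul_comm, ← div_eq_mul_inv, ENNReal.le_div_iff_mul_le
        (Or.inl (by simpa using hc)) (Or.inl ENNReal.ofReal_ne_top), mul_comm]
      exact hlow r
    have hb : (ENNReal.ofReal c)⁻¹ ≠ ⊤ := by simpa using hc
    refine (lintegral_mono fun x => ?_).trans_lt (b :=
      ∫⁻ x, ENNReal.ofReal (min (‖x‖ ^ 2) 1) + (ENNReal.ofReal c)⁻¹ * truncMoment g ‖x‖ ∂M) ?_
    · by_cases hx : 1 < ‖x‖
      · rw [indicator_of_mem (by exact hx)]
        exact (log_le_powerTruncMoment_zero hx).trans (add_le_add_right (hcm _) _)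
      · rw [indicator_of_notMem (by exact hx)]
        exact zero_le
    · rw [lintegral_add_left (by fun_prop), lintegral_const_mul' _ _ hb]
      exact ENNReal.add_lt_top.2 ⟨hM.2.2, ENNReal.mul_lt_top hb.lt_top hi⟩
  · intro hi
    refine lintegral_lt_top_of_le (by fun_prop) hml
      (a := C + T) (ENNReal.add_ne_top.2 ⟨hC, hT⟩) hC hM.2.2 hi
      (Filter.Eventually.of_forall fun x => (h ‖x‖).trans ?_)
    rw [add_mul, add_right_comm, ← mul_add]
    gcongr
    exact powerTruncMoment_zero_le (norm_nonneg x)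

lemma upsilonDomain_of_pos_of_lt_two (hg : IsPowerDensity α g) (hα0 : 0 < α) (hα2 : α < 2) :
    UpsilonDomain (E := E) (volume.withDensity g) = {M | MemMAlpha α M} := by
  ext M
  rw [mem_upsilonDomain_iff hg]
  constructor
  · rintro ⟨hM, hi⟩
    refine ⟨hM.2.1, ?_⟩
    obtain ⟨c, hc, hlow⟩ := hg.exists_le_truncMoment
    have h2α : 0 < 2 - α := by linarith
    set k : ℝ := c * ((1 / 2) ^ (2 - α) / (2 - α)) with hk
    have hk0 : 0 < k := by positivity
    have hle : ENNReal.ofReal k * ∫⁻ x, ENNReal.ofReal (min (‖x‖ ^ 2) (‖x‖ ^ α)) ∂M ≤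
        ∫⁻ x, truncMoment g ‖x‖ ∂M := by
      rw [← lintegral_const_mul _ (by fun_prop)]
      refine lintegral_mono_ae ?_
      filter_upwards [measure_eq_zero_iff_ae_notMem.1 hM.2.1] with x hx
      rw [hk, ENNReal.ofReal_mul hc.le, mul_assoc]
      refine le_trans ?_ (hlow _)
      gcongr
      exact le_powerTruncMoment hα2 (norm_pos_iff.2 hx)
    exact ENNReal.lt_top_of_mul_ne_top_right (hle.trans_lt hi).ne (by simpa using hk0)
  · rintro ⟨hM0, hi⟩
    have hmin : ∀ x : E, ENNReal.ofReal (min (‖x‖ ^ 2) 1) ≤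
        ENNReal.ofReal (min (‖x‖ ^ 2) (‖x‖ ^ α)) := fun x =>
      ENNReal.ofReal_le_ofReal (min_one_le_min_rpow hα0 hα2 (norm_nonneg x))
    refine ⟨isLevyMeasure_iff.2 ⟨hM0, (lintegral_mono hmin).trans_lt hi⟩, ?_⟩
    obtain ⟨C, T, hC, hT, h⟩ := hg.exists_truncMoment_le
    obtain ⟨D, hD⟩ := exists_powerTruncMoment_le hα0 hα2
    refine lintegral_lt_top_of_le (by fun_prop) (by fun_prop)
      (ENNReal.mul_ne_top hC (ENNReal.ofReal_ne_top (r := D))) hT hi hi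
      (Filter.Eventually.of_forall fun x => (h ‖x‖).trans (add_le_add ?_ ?_))
    · rw [mul_assoc]
      gcongr
      exact hD _ (norm_nonneg x)
    · exact mul_le_mul' le_rfl (hmin x)

lemma upsilonDomain_of_two_le (hg : IsPowerDensity α g) (hα : 2 ≤ α) :
    UpsilonDomain (E := E) (volume.withDensity g) = {0} := by
  ext M
  rw [mem_upsilonDomain_iff hg, mem_singleton_iff]
  constructor
  · rintro ⟨hM, hi⟩
    obtain ⟨c, hc, hlow⟩ := hg.exists_le_truncMoment
    by_contra hne
    refine hi.ne (top_le_iff.1 ?_)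
    have htop : ∫⁻ _ : E, (⊤ : ℝ≥0∞) ∂M = ⊤ := by
      rw [lintegral_const, ENNReal.top_mul]
      simpa using hne
    rw [← htop]
    refine lintegral_mono_ae ?_
    filter_upwards [measure_eq_zero_iff_ae_notMem.1 hM.2.1] with x hx
    have := hlow ‖x‖
    rwa [powerTruncMoment_eq_top hα (norm_pos_iff.2 hx), ENNReal.mul_top (by simpa using hc)]
      at this
  · rintro rfl
    exact ⟨isLevyMeasure_iff.2 (by simp), by simp⟩

lemma upsilonDomain_eq {g' : ℝ → ℝ≥0∞} (hg : IsPowerDensity α g) (hg' : IsPowerDensity α g') :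
    UpsilonDomain (E := E) (volume.withDensity g) =
      UpsilonDomain (volume.withDensity g') := by
  rcases lt_trichotomy α 0 with h | rfl | h
  · rw [hg.upsilonDomain_of_neg h, hg'.upsilonDomain_of_neg h]
  · rw [hg.upsilonDomain_zero, hg'.upsilonDomain_zero]
  · rcases lt_or_ge α 2 with h2 | h2
    · rw [hg.upsilonDomain_of_pos_of_lt_two h h2, hg'.upsilonDomain_of_pos_of_lt_two h h2]
    · rw [hg.upsilonDomain_of_two_le h2, hg'.upsilonDomain_of_two_le h2]

end IsPowerDensity

lemma min_one_le_rpow {w u e : ℝ} (hw : 0 < w) (hwu : w ≤ u) (hu : u ≤ 1) :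
    min (w ^ e) 1 ≤ u ^ e := by
  rcases le_total 0 e with he | he
  · exact (min_le_left _ _).trans (Real.rpow_le_rpow hw.le hwu he)
  · exact (min_le_right _ _).trans
      (Real.one_le_rpow_of_pos_of_le_one_of_nonpos (hw.trans_le hwu) hu he)

lemma rpow_le_max_one {w u e : ℝ} (hw : 0 < w) (hwu : w ≤ u) (hu : u ≤ 1) :
    u ^ e ≤ max (w ^ e) 1 := by
  rcases le_total 0 e with he | he
  · exact (Real.rpow_le_one (hw.le.trans hwu) hu he).trans (le_max_right _ _)
  · exact (Real.rpow_le_rpow_of_nonpos hw hwu he).trans (le_max_left _ _)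

lemma min_mul_one_sub_le_one_sub_rpow {p s : ℝ} (hp : 0 < p) (hs0 : 0 < s) (hs1 : s ≤ 1) :
    min p 1 * (1 - s) ≤ 1 - s ^ p := by
  rcases le_total p 1 with h | h
  · rw [min_eq_left h]
    have := rpow_one_add_le_one_add_mul_self (s := s - 1) (by linarith) hp.le h
    rw [add_sub_cancel] at this
    linarith
  · rw [min_eq_right h]
    have := Real.rpow_le_rpow_of_exponent_ge hs0 hs1 h
    rw [Real.rpow_one] at this
    linarith

lemma isPowerDensity_psi (α : ℝ) {p : ℝ} (hp : 0 < p) :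
    IsPowerDensity α fun s =>
      if 0 < s then ENNReal.ofReal (s ^ (-α - 1) * Real.exp (-(s ^ p))) else 0 where
  measurable := Measurable.ite measurableSet_Ioi (by fun_prop) measurable_const
  ne_top s := by split_ifs <;> simp
  eq_zero s hs := if_neg hs.not_gt
  lower := by
    refine ⟨Real.exp (-((1 / 2) ^ p)), Real.exp_pos _, fun s hs => ?_⟩
    have hs0 := hs.1
    rw [if_pos hs0, mul_comm]
    gcongr
    exact hs.2.le
  upper := by
    refine ⟨1, zero_le_one, fun s hs => ?_⟩
    have hs0 := hs.1
    rw [if_pos hs0, one_mul]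
    refine ENNReal.ofReal_le_ofReal (mul_le_of_le_one_right (by positivity) ?_)
    rw [Real.exp_le_one_iff]
    have := Real.rpow_nonneg hs0.le p
    linarith
  tail := by
    set b : ℝ := |1 - α|
    have hi := (integrableOn_rpow_mul_exp_neg_rpow (p := p) (s := b)
      (by linarith [abs_nonneg (1 - α)]) hp).const_mul ((1 / 2) ^ (1 - α - b))
    refine lt_of_le_of_lt ?_ hi.lintegral_lt_top
    refine (setLIntegral_mono' measurableSet_Ici fun s hs => ?_).trans
      (lintegral_mono_set fun s hs => lt_of_lt_of_le (by norm_num) (mem_Ici.1 hs))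
    have hs2 : (1 / 2 : ℝ) ≤ s := hs
    have hs0 : 0 < s := by linarith
    rw [if_pos hs0, ← ENNReal.ofReal_mul (by positivity)]
    refine ENNReal.ofReal_le_ofReal ?_
    have h1 : s ^ (-α - 1) * s ^ 2 = s ^ (1 - α - b) * s ^ b := by
      rw [← Real.rpow_natCast, ← Real.rpow_add hs0, ← Real.rpow_add hs0]
      congr 1; push_cast; ring
    have h2 : s ^ (1 - α - b) ≤ (1 / 2) ^ (1 - α - b) :=
      Real.rpow_le_rpow_of_nonpos (by norm_num) hs2 (by linarith [le_abs_self (1 - α)])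
    rw [mul_right_comm, h1, mul_assoc]
    gcongr

lemma Kconst_pos {α β p : ℝ} (hβα : β < α) (hp : 0 < p) : 0 < Kconst α β p := by
  rw [Kconst, integral_rpow_mul_exp_neg_rpow hp (by linarith), sub_add_cancel]
  exact mul_pos (by positivity) (Real.Gamma_pos_of_pos (div_pos (by linarith) hp))

lemma integrableOn_Ioo_one_sub_rpow {e : ℝ} (he : -1 < e) :
    IntegrableOn (fun s : ℝ => (1 - s) ^ e) (Ioo 0 1) := by
  have h := ((intervalIntegral.intervalIntegrable_rpow' (a := 0) (b := 1) he).comp_sub_left 1).symm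
  rw [sub_zero, sub_self, intervalIntegrable_iff_integrableOn_Ioo_of_le zero_le_one] at h
  exact h

lemma isPowerDensity_tau {β α p : ℝ} (hβα : β < α) (hp : 0 < p) :
    IsPowerDensity α fun s =>
      if 0 < s ∧ s < 1 then
        ENNReal.ofReal ((Kconst α β p)⁻¹ * (s ^ (-α - 1) * (1 - s ^ p) ^ ((α - β) / p - 1)))
      else 0 := by
  have hK := Kconst_pos hβα hp
  set K := (Kconst α β p)⁻¹
  have hK0 : 0 < K := inv_pos.2 hK
  set e := (α - β) / p - 1
  have he : -1 < e := by
    have : 0 < (α - β) / p := div_pos (by linarith) hp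
    simp only [e]; linarith
  have hw : 0 < 1 - (1 / 2 : ℝ) ^ p := by
    linarith [Real.rpow_lt_one (by norm_num : (0 : ℝ) ≤ 1 / 2) (by norm_num) hp]
  have hu : ∀ s ∈ Ioo (0 : ℝ) (1 / 2), 1 - (1 / 2 : ℝ) ^ p ≤ 1 - s ^ p ∧ 1 - s ^ p ≤ 1 :=
    fun s hs => ⟨by linarith [Real.rpow_le_rpow hs.1.le hs.2.le hp.le],
      by linarith [Real.rpow_nonneg hs.1.le p]⟩
  refine ⟨Measurable.ite measurableSet_Ioo (by fun_prop) measurable_const,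
    fun s => by split_ifs <;> simp, fun s hs => if_neg fun h => hs.not_gt h.1, ?_, ?_, ?_⟩
  · refine ⟨K * min ((1 - (1 / 2 : ℝ) ^ p) ^ e) 1, by positivity, fun s hs => ?_⟩
    have hs0 := hs.1
    rw [if_pos ⟨hs.1, by linarith [hs.2]⟩, mul_assoc, mul_comm (min _ _)]
    gcongr
    exact min_one_le_rpow hw (hu s hs).1 (hu s hs).2
  · refine ⟨K * max ((1 - (1 / 2 : ℝ) ^ p) ^ e) 1, by positivity, fun s hs => ?_⟩
    have hs0 := hs.1
    rw [if_pos ⟨hs.1, by linarith [hs.2]⟩, mul_assoc, mul_comm (max _ _)]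
    gcongr
    exact rpow_le_max_one hw (hu s hs).1 (hu s hs).2
  · have hκ : 0 < min p 1 := lt_min hp one_pos
    set A : ℝ := max ((1 / 2) ^ (1 - α)) 1
    have hi : IntegrableOn (fun s : ℝ => K * A * (min p 1 ^ e * (1 - s) ^ e + 1)) (Ioo 0 1) :=
      (((integrableOn_Ioo_one_sub_rpow he).const_mul _).add
        (integrableOn_const (by simp))).const_mul _
    refine lt_of_le_of_lt ?_ hi.lintegral_lt_top
    rw [← lintegral_indicator measurableSet_Ioo]
    refine (setLIntegral_mono' measurableSet_Ici fun s hs => ?_).trans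
      (setLIntegral_le_lintegral (Ici (1 / 2)) _)
    have hs2 : (1 / 2 : ℝ) ≤ s := hs
    have hs0 : 0 < s := by linarith
    split_ifs with h
    · rw [indicator_of_mem (show s ∈ Ioo (0 : ℝ) 1 from h)]
      have hs1 : 0 < 1 - s := by linarith [h.2]
      have hle := min_mul_one_sub_le_one_sub_rpow hp hs0 h.2.le
      have hpos : 0 < 1 - s ^ p := (mul_pos hκ hs1).trans_le hle
      rw [← ENNReal.ofReal_mul (by positivity)]
      refine ENNReal.ofReal_le_ofReal ?_
      have h1 : s ^ (-α - 1) * s ^ 2 = s ^ (1 - α) := by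
        rw [← Real.rpow_natCast, ← Real.rpow_add hs0]; congr 1; push_cast; ring
      rw [mul_assoc, mul_right_comm, h1, mul_assoc]
      gcongr
      · exact rpow_le_max_one (by norm_num) hs2 h.2.le
      · refine (rpow_le_max_one (mul_pos hκ hs1) hle
          (by linarith [Real.rpow_nonneg hs0.le p])).trans ?_
        rw [Real.mul_rpow hκ.le hs1.le]
        exact max_le_add_of_nonneg (by positivity) zero_le_one
    · simp

theorem stmt1 (d : ℕ) (hd : 1 ≤ d) (β α p : ℝ) (hβα : β < α) (hp : 0 < p) :
    (α < 0 →
      UpsilonDomain (E := EuclideanSpace ℝ (Fin d)) (tauMeasure β α p) =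
        {M | IsLevyMeasure M}) ∧
    (α = 0 →
      UpsilonDomain (E := EuclideanSpace ℝ (Fin d)) (tauMeasure β α p) =
        {M | MemMLog M}) ∧
    (0 < α → α < 2 →
      UpsilonDomain (E := EuclideanSpace ℝ (Fin d)) (tauMeasure β α p) =
        {M | MemMAlpha α M}) ∧
    (2 ≤ α →
      UpsilonDomain (E := EuclideanSpace ℝ (Fin d)) (tauMeasure β α p) = {0}) ∧
    UpsilonDomain (E := EuclideanSpace ℝ (Fin d)) (tauMeasure β α p) =
      UpsilonDomain (psiMeasure α p) := by
  have hτ := isPowerDensity_tau hβα hp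
  refine ⟨fun h => hτ.upsilonDomain_of_neg h, ?_,
    fun h0 h2 => hτ.upsilonDomain_of_pos_of_lt_two h0 h2, fun h => hτ.upsilonDomain_of_two_le h,
    hτ.upsilonDomain_eq (isPowerDensity_psi α hp)⟩
  rintro rfl
  exact hτ.upsilonDomain_zero
end
end

section
/- Let d ≥ 1, α ∈ ℝ and 0 < r < q < p < ∞. Then the range of 𝔓_{α,q→r} is contained in the domain of 𝔓_{α,p→q}: every Lévy measure of the form 𝔓_{α,q→r} M with M ∈ 𝔇(𝔓_{α,q→r}) belongs to 𝔇(𝔓_{α,p→q}). -/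
open MeasureTheory Set

noncomputable section

variable {E : Type*} [NormedAddCommGroup E] [NormedSpace ℝ E]
  [MeasurableSpace E] [BorelSpace E]

/-- A probability measure on `(0, ∞)` with Laplace transform `t ↦ exp (-t ^ ρ)`. -/
structure IsStableLaw (ρ : ℝ) (μ : Measure ℝ) : Prop where
  prob : IsProbabilityMeasure μ
  pos : ∀ᵐ x ∂μ, 0 < x
  laplace : ∀ t : ℝ, 0 ≤ t →
    ∫⁻ x, ENNReal.ofReal (Real.exp (-(t * x))) ∂μ = ENNReal.ofReal (Real.exp (-(t ^ ρ)))

/-- The law on `(0, ∞)` with density `f`. -/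
def stableLaw (f : ℝ → ℝ) : Measure ℝ :=
  (volume.restrict (Ioi (0 : ℝ))).withDensity fun x => ENNReal.ofReal (f x)

theorem IsStableDensity.isStableLaw {ρ : ℝ} (hρ : 0 < ρ) {f : ℝ → ℝ}
    (hf : IsStableDensity ρ f) : IsStableLaw ρ (stableLaw f) := by
  obtain ⟨hm, h0, hL⟩ := hf
  have key : ∀ t : ℝ, 0 ≤ t →
      ∫⁻ x, ENNReal.ofReal (Real.exp (-(t * x))) ∂(stableLaw f)
        = ENNReal.ofReal (Real.exp (-(t ^ ρ))) := by
    intro t ht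
    have hint : Integrable (fun x => Real.exp (-(t * x)) * f x) (volume.restrict (Ioi 0)) := by
      by_contra hc
      have h := hL t ht
      rw [integral_undef hc] at h
      exact (Real.exp_pos _).ne h
    rw [← hL t ht, ofReal_integral_eq_lintegral_ofReal hint
      (ae_of_all _ fun x => mul_nonneg (Real.exp_pos _).le (h0 x)), stableLaw,
      lintegral_withDensity_eq_lintegral_mul _ (by fun_prop) (by fun_prop)]
    refine lintegral_congr fun x => ?_
    rw [Pi.mul_apply, ENNReal.ofReal_mul (Real.exp_pos _).le, mul_comm]
  refine ⟨⟨?_⟩, ?_, key⟩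
  · have h := key 0 le_rfl
    simpa [Real.zero_rpow hρ.ne'] using h
  · exact (withDensity_absolutelyContinuous _ _).ae_le (ae_restrict_mem measurableSet_Ioi)

theorem min_one_le_two_mul_one_sub_exp_neg {v : ℝ} (hv : 0 ≤ v) :
    min v 1 ≤ 2 * (1 - Real.exp (-v)) := by
  have h1 : (1 + v) * Real.exp (-v) ≤ 1 := by
    calc (1 + v) * Real.exp (-v) ≤ Real.exp v * Real.exp (-v) := by
          gcongr
          linarith [Real.add_one_le_exp v]
      _ = 1 := by rw [← Real.exp_add]; simp
  have h2 : Real.exp (-v) ≤ 1 / (1 + v) := by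
    rw [le_div_iff₀ (by positivity)]
    linarith
  have h3 : min v 1 ≤ 2 * (1 - 1 / (1 + v)) := by
    have : 1 - 1 / (1 + v) = v / (1 + v) := by field_simp; ring
    rw [this, ← mul_div_assoc, le_div_iff₀ (by positivity)]
    rcases le_total v 1 with h | h
    · rw [min_eq_left h]; nlinarith
    · rw [min_eq_right h]; linarith
  linarith

namespace IsStableLaw

variable {ρ : ℝ} {μ : Measure ℝ}

theorem lintegral_one_sub_exp (h : IsStableLaw ρ μ) {t : ℝ} (ht : 0 ≤ t) :
    ∫⁻ x, ENNReal.ofReal (1 - Real.exp (-(t * x))) ∂μ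
      = ENNReal.ofReal (1 - Real.exp (-(t ^ ρ))) := by
  have := h.prob
  have hsum : ∫⁻ x, ENNReal.ofReal (1 - Real.exp (-(t * x))) ∂μ
      + ∫⁻ x, ENNReal.ofReal (Real.exp (-(t * x))) ∂μ = 1 := by
    rw [← lintegral_add_right _ (by fun_prop)]
    calc _ = ∫⁻ x, 1 ∂μ := by
          refine lintegral_congr_ae ?_
          filter_upwards [h.pos] with x hx
          rw [← ENNReal.ofReal_add _ (Real.exp_pos _).le, sub_add_cancel, ENNReal.ofReal_one]
          have : Real.exp (-(t * x)) ≤ 1 := Real.exp_le_one_iff.2 (by nlinarith)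
          linarith
      _ = 1 := by simp
  rw [h.laplace t ht] at hsum
  rw [ENNReal.ofReal_sub _ (Real.exp_pos _).le, ENNReal.ofReal_one]
  exact ENNReal.eq_sub_of_add_eq ENNReal.ofReal_ne_top hsum

theorem lintegral_min_le (h : IsStableLaw ρ μ) {x : ℝ} (hx : 0 < x) :
    ∫⁻ y, ENNReal.ofReal (min (y / x) 1) ∂μ ≤ ENNReal.ofReal (2 * x ^ (-ρ)) := by
  calc ∫⁻ y, ENNReal.ofReal (min (y / x) 1) ∂μ
      ≤ ∫⁻ y, ENNReal.ofReal 2 * ENNReal.ofReal (1 - Real.exp (-(x⁻¹ * y))) ∂μ := by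
        refine lintegral_mono_ae ?_
        filter_upwards [h.pos] with y hy
        rw [← ENNReal.ofReal_mul (by norm_num)]
        refine ENNReal.ofReal_le_ofReal ?_
        rw [div_eq_inv_mul]
        exact min_one_le_two_mul_one_sub_exp_neg (by positivity)
    _ = ENNReal.ofReal 2 * ENNReal.ofReal (1 - Real.exp (-(x⁻¹ ^ ρ))) := by
        rw [lintegral_const_mul _ (by fun_prop), h.lintegral_one_sub_exp (by positivity)]
    _ ≤ ENNReal.ofReal (2 * x ^ (-ρ)) := by
        rw [← ENNReal.ofReal_mul (by norm_num), Real.rpow_neg hx.le, ← Real.inv_rpow hx.le]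
        refine ENNReal.ofReal_le_ofReal ?_
        have := Real.add_one_le_exp (-(x⁻¹ ^ ρ))
        linarith

theorem measure_Ici_le (h : IsStableLaw ρ μ) {x : ℝ} (hx : 0 < x) :
    μ (Ici x) ≤ ENNReal.ofReal (2 * x ^ (-ρ)) := by
  refine le_trans ?_ (h.lintegral_min_le hx)
  rw [← lintegral_indicator_one measurableSet_Ici]
  refine lintegral_mono fun y => ?_
  by_cases hy : y ∈ Ici x
  · have : 1 ≤ y / x := by rw [le_div_iff₀ hx]; simpa using hy
    simp [indicator_of_mem hy, min_eq_right this]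
  · simp [indicator_of_notMem hy]

theorem exists_le_measure_Ico (h : IsStableLaw ρ μ) (h0 : 0 < ρ) (h1 : ρ < 1) :
    ∃ l c : ℝ, 1 < l ∧ 0 < c ∧
      ∀ x : ℝ, 1 ≤ x → ENNReal.ofReal (c * x ^ (-ρ)) ≤ μ (Ico x (l * x)) := by
  have hρ1 : 0 < 1 - ρ := by linarith
  set ε : ℝ := (1 / 16 : ℝ) ^ (1 / (1 - ρ)) with hε
  have hε0 : 0 < ε := by positivity
  have hε1 : ε ≤ 1 := Real.rpow_le_one (by norm_num) (by norm_num) (by positivity)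
  have hεe : ε = ε ^ ρ * (1 / 16) := by
    have : ε ^ (1 - ρ) = 1 / 16 := by
      rw [hε, ← Real.rpow_mul (by norm_num), one_div_mul_cancel hρ1.ne', Real.rpow_one]
    rw [← this, ← Real.rpow_add hε0]
    simp
  set l : ℝ := (16 : ℝ) ^ (1 / ρ) / ε with hl
  have h16 : (1 : ℝ) < (16 : ℝ) ^ (1 / ρ) := Real.one_lt_rpow (by norm_num) (by positivity)
  have hl1 : 1 < l := by
    rw [hl, lt_div_iff₀ hε0]; linarith
  have hl0 : 0 < l := by linarith
  have hlρ : l ^ (-ρ) = ε ^ ρ * (1 / 16) := by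
    rw [hl, Real.rpow_neg (by positivity), Real.div_rpow (by positivity) hε0.le,
      ← Real.rpow_mul (by norm_num), one_div_mul_cancel h0.ne', Real.rpow_one]
    field_simp
  refine ⟨l, ε ^ ρ / 4, hl1, by positivity, fun x hx => ?_⟩
  have hx0 : 0 < x := by linarith
  have hxρ : 0 < x ^ (-ρ) := by positivity
  have hpt : ∀ y : ℝ, 0 < y → ENNReal.ofReal (1 - Real.exp (-(ε / x * y))) ≤
      ENNReal.ofReal ε * ENNReal.ofReal (min (y / x) 1)
        + ENNReal.ofReal (min (y / (l * x)) 1) + (Ico x (l * x)).indicator 1 y := by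
    intro y hy
    by_cases hm : y ∈ Ico x (l * x)
    · rw [indicator_of_mem hm, Pi.one_apply]
      refine le_trans ?_ le_add_self
      rw [← ENNReal.ofReal_one]
      exact ENNReal.ofReal_le_ofReal (by linarith [Real.exp_pos (-(ε / x * y))])
    · rcases lt_or_ge y x with hyx | hyx
      · refine le_trans ?_ (le_trans le_self_add le_self_add)
        rw [← ENNReal.ofReal_mul hε0.le, min_eq_left ((div_le_one hx0).2 hyx.le)]
        refine ENNReal.ofReal_le_ofReal ?_
        have := Real.add_one_le_exp (-(ε / x * y))
        have h2 : ε / x * y = ε * (y / x) := by ring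
        linarith
      · have hy2 : l * x ≤ y := by
          by_contra hc
          exact hm ⟨hyx, not_le.1 hc⟩
        refine le_trans ?_ (le_trans le_add_self le_self_add)
        rw [min_eq_right ((one_le_div (by positivity)).2 hy2)]
        exact ENNReal.ofReal_le_ofReal (by linarith [Real.exp_pos (-(ε / x * y))])
  have hint : ENNReal.ofReal (1 - Real.exp (-((ε / x) ^ ρ))) ≤
      ENNReal.ofReal ε * ENNReal.ofReal (2 * x ^ (-ρ))
        + ENNReal.ofReal (2 * (l * x) ^ (-ρ)) + μ (Ico x (l * x)) := by
    rw [← h.lintegral_one_sub_exp (by positivity)]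
    calc _ ≤ ∫⁻ y, (ENNReal.ofReal ε * ENNReal.ofReal (min (y / x) 1)
        + ENNReal.ofReal (min (y / (l * x)) 1) + (Ico x (l * x)).indicator 1 y) ∂μ := by
          refine lintegral_mono_ae ?_
          filter_upwards [h.pos] with y hy using hpt y hy
      _ = ENNReal.ofReal ε * ∫⁻ y, ENNReal.ofReal (min (y / x) 1) ∂μ
        + ∫⁻ y, ENNReal.ofReal (min (y / (l * x)) 1) ∂μ + μ (Ico x (l * x)) := by
          rw [lintegral_add_right _ (measurable_one.indicator measurableSet_Ico),
            lintegral_add_right _ (by fun_prop), lintegral_const_mul _ (by fun_prop),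
            lintegral_indicator_one measurableSet_Ico]
      _ ≤ _ := by
          gcongr
          · exact h.lintegral_min_le hx0
          · exact h.lintegral_min_le (by positivity)
  rw [← ENNReal.ofReal_mul hε0.le, ← ENNReal.ofReal_add (by positivity) (by positivity)] at hint
  have hsub := tsub_le_iff_left.2 hint
  rw [← ENNReal.ofReal_sub _ (by positivity)] at hsub
  refine le_trans (ENNReal.ofReal_le_ofReal ?_) hsub
  have e1 : (ε / x) ^ ρ = ε ^ ρ * x ^ (-ρ) := by
    rw [Real.div_rpow hε0.le hx0.le, Real.rpow_neg hx0.le, div_eq_mul_inv]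
  have e2 : (ε / x) ^ ρ ≤ 1 :=
    Real.rpow_le_one (by positivity) ((div_le_one hx0).2 (by linarith)) h0.le
  have e3 := min_one_le_two_mul_one_sub_exp_neg (v := (ε / x) ^ ρ) (by positivity)
  rw [min_eq_left e2] at e3
  have e4 : (l * x) ^ (-ρ) = ε ^ ρ * (1 / 16) * x ^ (-ρ) := by
    rw [Real.mul_rpow hl0.le hx0.le, hlρ]
  have e5 : ε * (2 * x ^ (-ρ)) = ε ^ ρ * (1 / 16) * (2 * x ^ (-ρ)) := by
    rw [← hεe]
  rw [e4, e5]
  rw [e1] at e3 ⊢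
  linarith

theorem lintegral_rpow_neg_lt_top (h : IsStableLaw ρ μ) (h0 : 0 < ρ) {b : ℝ} (hb : 0 < b) :
    ∫⁻ x, ENNReal.ofReal (x ^ (-b)) ∂μ < ⊤ := by
  have := h.prob
  have hG := Real.Gamma_pos_of_pos hb
  have hΓ : ∀ x : ℝ, 0 < x →
      ∫⁻ t in Ioi (0 : ℝ), ENNReal.ofReal (t ^ (b - 1)) * ENNReal.ofReal (Real.exp (-(x * t)))
        = ENNReal.ofReal (Real.Gamma b) * ENNReal.ofReal (x ^ (-b)) := by
    intro x hx
    have e := Real.integral_rpow_mul_exp_neg_mul_Ioi hb hx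
    have hint : Integrable (fun t => t ^ (b - 1) * Real.exp (-(x * t)))
        (volume.restrict (Ioi (0 : ℝ))) := by
      by_contra hc
      rw [integral_undef hc] at e
      have : 0 < (1 / x) ^ b * Real.Gamma b := by positivity
      linarith
    rw [← ENNReal.ofReal_mul hG.le, Real.rpow_neg hx.le, ← Real.inv_rpow hx.le, mul_comm, ← one_div,
      ← e, ofReal_integral_eq_lintegral_ofReal hint]
    · refine setLIntegral_congr_fun measurableSet_Ioi fun t ht => ?_
      exact (ENNReal.ofReal_mul (Real.rpow_nonneg (le_of_lt ht) _)).symm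
    · refine (ae_restrict_iff' measurableSet_Ioi).2 (ae_of_all _ fun t ht => ?_)
      exact mul_nonneg (Real.rpow_nonneg (le_of_lt ht) _) (Real.exp_pos _).le
  have hfin : ENNReal.ofReal (Real.Gamma b) * ∫⁻ x, ENNReal.ofReal (x ^ (-b)) ∂μ < ⊤ := by
    calc ENNReal.ofReal (Real.Gamma b) * ∫⁻ x, ENNReal.ofReal (x ^ (-b)) ∂μ
        = ∫⁻ x, (∫⁻ t in Ioi (0 : ℝ),
            ENNReal.ofReal (t ^ (b - 1)) * ENNReal.ofReal (Real.exp (-(x * t)))) ∂μ := by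
          rw [← lintegral_const_mul _ (by fun_prop)]
          refine lintegral_congr_ae ?_
          filter_upwards [h.pos] with x hx
          exact (hΓ x hx).symm
      _ = ∫⁻ t in Ioi (0 : ℝ), (∫⁻ x,
            ENNReal.ofReal (t ^ (b - 1)) * ENNReal.ofReal (Real.exp (-(x * t))) ∂μ) := by
          rw [lintegral_lintegral_swap]
          fun_prop
      _ = ∫⁻ t in Ioi (0 : ℝ), ENNReal.ofReal (t ^ (b - 1) * Real.exp (-(t ^ ρ))) := by
          refine setLIntegral_congr_fun measurableSet_Ioi fun t ht => ?_
          have ht' : 0 ≤ t := le_of_lt ht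
          rw [lintegral_const_mul _ (by fun_prop), ENNReal.ofReal_mul (Real.rpow_nonneg ht' _),
            ← h.laplace t ht']
          exact congrArg _ (lintegral_congr fun x => by rw [mul_comm])
      _ < ⊤ := by
          have e := integral_rpow_mul_exp_neg_rpow h0 (q := b - 1) (by linarith)
          have hint : Integrable (fun t => t ^ (b - 1) * Real.exp (-(t ^ ρ)))
              (volume.restrict (Ioi (0 : ℝ))) := by
            by_contra hc
            rw [integral_undef hc] at e
            have : 0 < 1 / ρ * Real.Gamma ((b - 1 + 1) / ρ) :=
              mul_pos (by positivity) (Real.Gamma_pos_of_pos (by rw [sub_add_cancel]; positivity))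
            linarith
          exact hint.lintegral_lt_top
  by_contra hc
  rw [not_lt, top_le_iff] at hc
  rw [hc, ENNReal.mul_top (by simpa using hG)] at hfin
  exact lt_irrefl _ hfin

/-- Products `x * y ^ (1 / σ)` of independent stable variables are stable. -/
theorem map_prod {σ : ℝ} {ν : Measure ℝ} (hμ : IsStableLaw σ μ) (hν : IsStableLaw ρ ν)
    (hσ : 0 < σ) :
    IsStableLaw (σ * ρ) ((μ.prod ν).map fun z => z.1 * z.2 ^ (1 / σ)) := by
  have := hμ.prob
  have := hν.prob
  have hm : Measurable fun z : ℝ × ℝ => z.1 * z.2 ^ (1 / σ) := by fun_prop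
  have hp : ∀ᵐ z ∂μ.prod ν, 0 < z.1 ∧ 0 < z.2 :=
    (Measure.quasiMeasurePreserving_fst.ae hμ.pos).and
      (Measure.quasiMeasurePreserving_snd.ae hν.pos)
  refine ⟨Measure.isProbabilityMeasure_map hm.aemeasurable, ?_, fun t ht => ?_⟩
  · rw [ae_map_iff hm.aemeasurable measurableSet_Ioi]
    filter_upwards [hp] with z hz
    exact mul_pos hz.1 (Real.rpow_pos_of_pos hz.2 _)
  · rw [lintegral_map (by fun_prop) hm, lintegral_prod_symm _ (by fun_prop),
      Real.rpow_mul ht, ← hν.laplace _ (Real.rpow_nonneg ht _)]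
    refine lintegral_congr_ae ?_
    filter_upwards [hν.pos] with y hy
    have e := hμ.laplace (t * y ^ (1 / σ)) (by positivity)
    rw [Real.mul_rpow ht (by positivity), ← Real.rpow_mul hy.le, one_div_mul_cancel hσ.ne',
      Real.rpow_one] at e
    rw [← e]
    refine lintegral_congr fun x => ?_
    ring_nf

end IsStableLaw

/-- The truncated square `u² ∧ 1`. -/
def truncSq (u : ℝ) : ENNReal := ENNReal.ofReal (min (u ^ 2) 1)

@[fun_prop]
theorem measurable_truncSq : Measurable truncSq := by
  unfold truncSq
  fun_prop

theorem truncSq_mono {u v : ℝ} (hu : 0 ≤ u) (huv : u ≤ v) : truncSq u ≤ truncSq v := by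
  unfold truncSq
  gcongr

theorem truncSq_mul_le {c u : ℝ} (hc : 1 ≤ c) :
    truncSq (c * u) ≤ ENNReal.ofReal (c ^ 2) * truncSq u := by
  unfold truncSq
  rw [← ENNReal.ofReal_mul (by positivity)]
  refine ENNReal.ofReal_le_ofReal ?_
  rw [mul_min_of_nonneg _ _ (by positivity), mul_pow]
  exact min_le_min le_rfl (by nlinarith)

theorem rpow_le_rpow_abs_mul {l v w : ℝ} (hl : 1 ≤ l) (hv : 0 < v) (hw : 0 < w)
    (hvw : v ≤ l * w) (hwv : w ≤ l * v) (γ : ℝ) : v ^ γ ≤ l ^ |γ| * w ^ γ := by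
  have hl0 : 0 < l := by linarith
  rcases le_total 0 γ with h | h
  · rw [abs_of_nonneg h, ← Real.mul_rpow hl0.le hw.le]
    exact Real.rpow_le_rpow hv.le hvw h
  · rw [abs_of_nonpos h, Real.rpow_neg hl0.le, ← Real.inv_rpow hl0.le,
      ← Real.mul_rpow (by positivity) hw.le]
    refine Real.rpow_le_rpow_of_nonpos (by positivity) ?_ h
    rw [inv_mul_le_iff₀ hl0]
    exact hwv

/-- The weighted test function `v ↦ v ^ γ * ((a * v ^ (-δ))² ∧ 1)`. -/
def weightedTruncSq (γ δ a v : ℝ) : ENNReal :=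
  ENNReal.ofReal (v ^ γ) * truncSq (a * v ^ (-δ))

@[fun_prop]
theorem measurable_weightedTruncSq (γ δ a : ℝ) : Measurable (weightedTruncSq γ δ a) := by
  unfold weightedTruncSq
  fun_prop

theorem weightedTruncSq_le {γ δ a l v w : ℝ} (hδ : 0 ≤ δ) (ha : 0 ≤ a) (hl : 1 ≤ l)
    (hv : 0 < v) (hw : 0 < w) (hvw : v ≤ l * w) (hwv : w ≤ l * v) :
    weightedTruncSq γ δ a v ≤
      ENNReal.ofReal (l ^ |γ| * (l ^ δ) ^ 2) * weightedTruncSq γ δ a w := by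
  have hl0 : 0 < l := by linarith
  have h1 := rpow_le_rpow_abs_mul hl hv hw hvw hwv γ
  have h2 := rpow_le_rpow_abs_mul hl hv hw hvw hwv (-δ)
  rw [abs_neg, abs_of_nonneg hδ] at h2
  unfold weightedTruncSq
  calc ENNReal.ofReal (v ^ γ) * truncSq (a * v ^ (-δ))
      ≤ ENNReal.ofReal (l ^ |γ| * w ^ γ) * truncSq (l ^ δ * (a * w ^ (-δ))) := by
        gcongr
        refine truncSq_mono (by positivity) ?_
        calc a * v ^ (-δ) ≤ a * (l ^ δ * w ^ (-δ)) := by gcongr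
          _ = l ^ δ * (a * w ^ (-δ)) := by ring
    _ ≤ ENNReal.ofReal (l ^ |γ| * w ^ γ) *
        (ENNReal.ofReal ((l ^ δ) ^ 2) * truncSq (a * w ^ (-δ))) := by
        gcongr
        exact truncSq_mul_le (Real.one_le_rpow hl hδ)
    _ = _ := by
        rw [ENNReal.ofReal_mul (by positivity), ENNReal.ofReal_mul (by positivity)]
        ring

/-- If `ν` is dominated by `μ` on geometric blocks, then integrals over `[1, ∞)` of functions
that are essentially constant on such blocks are dominated too. -/
theorem setLIntegral_Ici_one_le {ν μ : Measure ℝ} {l : ℝ} (hl : 1 < l) {D K : ENNReal}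
    (hD : ∀ x : ℝ, 1 ≤ x → ν (Ico x (l * x)) ≤ D * μ (Ico x (l * x))) {φ : ℝ → ENNReal}
    (hφm : Measurable φ)
    (hφ : ∀ v w : ℝ, 0 < v → 0 < w → v ≤ l * w → w ≤ l * v → φ v ≤ K * φ w) :
    ∫⁻ v in Ici (1 : ℝ), φ v ∂ν ≤ K * D * K * ∫⁻ v, φ v ∂μ := by
  have hl0 : 0 < l := by linarith
  set I : ℕ → Set ℝ := fun n => Ico (l ^ n) (l * l ^ n) with hI
  have hIm : ∀ n, MeasurableSet (I n) := fun n => measurableSet_Ico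
  have hpow : ∀ n : ℕ, 1 ≤ l ^ n := fun n => one_le_pow₀ hl.le
  have hcover : Ici (1 : ℝ) ⊆ ⋃ n, I n := by
    intro x hx
    obtain ⟨n, h1, h2⟩ := exists_nat_pow_near hx hl
    exact mem_iUnion.2 ⟨n, h1, by rwa [← pow_succ']⟩
  have hdisj : Pairwise (Function.onFun Disjoint I) := by
    rw [pairwise_disjoint_on]
    intro m n hmn
    refine Set.disjoint_left.2 fun x hx hx' => ?_
    have h1 : l ^ (m + 1) ≤ l ^ n := pow_le_pow_right₀ hl.le hmn
    rw [pow_succ'] at h1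
    exact absurd (hx.2.trans_le h1) (not_lt.2 hx'.1)
  have hblock : ∀ n, ∫⁻ v in I n, φ v ∂ν ≤ K * D * K * ∫⁻ v in I n, φ v ∂μ := by
    intro n
    have hn0 : 0 < l ^ n := by positivity
    have hmem : ∀ v ∈ I n, 0 < v ∧ v ≤ l * l ^ n ∧ l ^ n ≤ l * v := fun v hv =>
      ⟨hn0.trans_le hv.1, hv.2.le, hv.1.trans (by nlinarith [hv.1])⟩
    calc ∫⁻ v in I n, φ v ∂ν ≤ ∫⁻ v in I n, K * φ (l ^ n) ∂ν := by
          refine setLIntegral_mono measurable_const fun v hv => ?_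
          obtain ⟨h1, h2, h3⟩ := hmem v hv
          exact hφ _ _ h1 hn0 h2 h3
      _ = K * φ (l ^ n) * ν (I n) := setLIntegral_const _ _
      _ ≤ K * φ (l ^ n) * (D * μ (I n)) := by
          gcongr
          exact hD _ (hpow n)
      _ = K * D * ∫⁻ v in I n, φ (l ^ n) ∂μ := by
          rw [setLIntegral_const]
          ring
      _ ≤ K * D * ∫⁻ v in I n, K * φ v ∂μ := by
          refine mul_le_mul_right (setLIntegral_mono (by fun_prop) fun v hv => ?_) _
          obtain ⟨h1, h2, h3⟩ := hmem v hv
          exact hφ _ _ hn0 h1 h3 h2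
      _ = K * D * K * ∫⁻ v in I n, φ v ∂μ := by
          rw [lintegral_const_mul _ hφm]
          ring
  calc ∫⁻ v in Ici (1 : ℝ), φ v ∂ν ≤ ∫⁻ v in ⋃ n, I n, φ v ∂ν := lintegral_mono_set hcover
    _ ≤ ∑' n, ∫⁻ v in I n, φ v ∂ν := lintegral_iUnion_le _ _
    _ ≤ ∑' n, K * D * K * ∫⁻ v in I n, φ v ∂μ := ENNReal.tsum_le_tsum hblock
    _ = K * D * K * ∫⁻ v in ⋃ n, I n, φ v ∂μ := by
        rw [ENNReal.tsum_mul_left, lintegral_iUnion hIm hdisj]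
    _ ≤ K * D * K * ∫⁻ v, φ v ∂μ := by
        exact mul_le_mul_right (setLIntegral_le_lintegral _ _) _

theorem IsStableLaw.exists_lintegral_weightedTruncSq_le {ρ θ γ δ : ℝ} {μ κ : Measure ℝ}
    (hμ : IsStableLaw ρ μ) (hκ : IsStableLaw (θ * ρ) κ) (h0 : 0 < ρ) (h1 : ρ < 1) (hθ : 0 < θ)
    (hδ : 0 < δ) :
    ∃ A B : ENNReal, A ≠ ⊤ ∧ B ≠ ⊤ ∧ ∀ a : ℝ, 0 ≤ a →
      ∫⁻ z, weightedTruncSq γ δ a (z ^ θ) ∂κ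
        ≤ A * ∫⁻ y, weightedTruncSq γ δ a y ∂μ + B * truncSq a := by
  obtain ⟨l, c, hl, hc, hlow⟩ := hμ.exists_le_measure_Ico h0 h1
  have hθm : Measurable fun z : ℝ => z ^ θ := by fun_prop
  set ν : Measure ℝ := κ.map fun z => z ^ θ with hν
  have hνpos : ∀ᵐ v ∂ν, 0 < v := by
    rw [ae_map_iff hθm.aemeasurable measurableSet_Ioi]
    filter_upwards [hκ.pos] with z hz using Real.rpow_pos_of_pos hz _
  have hD : ∀ x : ℝ, 1 ≤ x →
      ν (Ico x (l * x)) ≤ ENNReal.ofReal (2 / c) * μ (Ico x (l * x)) := by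
    intro x hx
    have hx0 : 0 < x := by linarith
    calc ν (Ico x (l * x)) ≤ ν (Ici x) := measure_mono Ico_subset_Ici_self
      _ = κ ((fun z => z ^ θ) ⁻¹' Ici x) := Measure.map_apply hθm measurableSet_Ici
      _ ≤ κ (Ici (x ^ (1 / θ))) := by
          refine measure_mono_ae ?_
          filter_upwards [hκ.pos] with z hz hzx
          have h2 : (x ^ (1 / θ)) ≤ (z ^ θ) ^ (1 / θ) :=
            Real.rpow_le_rpow hx0.le hzx (by positivity)
          rwa [← Real.rpow_mul hz.le, mul_one_div_cancel hθ.ne', Real.rpow_one] at h2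
      _ ≤ ENNReal.ofReal (2 * (x ^ (1 / θ)) ^ (-(θ * ρ))) := hκ.measure_Ici_le (by positivity)
      _ = ENNReal.ofReal (2 / c) * ENNReal.ofReal (c * x ^ (-ρ)) := by
          rw [← Real.rpow_mul hx0.le, ← ENNReal.ofReal_mul (by positivity)]
          congr 1
          have : 1 / θ * -(θ * ρ) = -ρ := by field_simp
          rw [this]
          field_simp
      _ ≤ _ := by
          gcongr
          exact hlow x hx
  set K : ENNReal := ENNReal.ofReal (l ^ |γ| * (l ^ δ) ^ 2) with hK
  set b : ℝ := |γ| + 2 * δ with hb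
  have hb0 : 0 < b := by positivity
  refine ⟨K * ENNReal.ofReal (2 / c) * K, ∫⁻ z, ENNReal.ofReal (z ^ (-(θ * b))) ∂κ,
    by simp [hK, ENNReal.mul_eq_top],
    (hκ.lintegral_rpow_neg_lt_top (by positivity) (by positivity)).ne, fun a ha => ?_⟩
  rw [← lintegral_map (f := weightedTruncSq γ δ a) (by fun_prop) hθm, ← hν,
    ← lintegral_add_compl _ (measurableSet_Ici (a := (1 : ℝ)))]
  refine add_le_add (setLIntegral_Ici_one_le hl hD (by fun_prop)
    fun v w hv hw => weightedTruncSq_le hδ.le ha hl.le hv hw) ?_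
  have hsmall : ∀ᵐ v ∂ν, v ∈ (Ici (1 : ℝ))ᶜ →
      weightedTruncSq γ δ a v ≤ ENNReal.ofReal (v ^ (-b)) * truncSq a := by
    filter_upwards [hνpos] with v hv hv1
    have hv1' : v < 1 := by simpa using hv1
    have h2 : 1 ≤ v ^ (-δ) := Real.one_le_rpow_of_pos_of_le_one_of_nonpos hv hv1'.le (by linarith)
    calc weightedTruncSq γ δ a v
        ≤ ENNReal.ofReal (v ^ γ) * (ENNReal.ofReal ((v ^ (-δ)) ^ 2) * truncSq a) := by
          unfold weightedTruncSq
          rw [mul_comm a]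
          gcongr
          exact truncSq_mul_le h2
      _ = ENNReal.ofReal (v ^ (γ + -δ * 2)) * truncSq a := by
          rw [← mul_assoc, ← ENNReal.ofReal_mul (by positivity), Real.rpow_add hv,
            Real.rpow_mul hv.le, Real.rpow_two]
      _ ≤ ENNReal.ofReal (v ^ (-b)) * truncSq a := by
          gcongr ENNReal.ofReal ?_ * _
          refine Real.rpow_le_rpow_of_exponent_ge hv hv1'.le ?_
          linarith [neg_abs_le γ]
  calc ∫⁻ v in (Ici (1 : ℝ))ᶜ, weightedTruncSq γ δ a v ∂ν
      ≤ ∫⁻ v in (Ici (1 : ℝ))ᶜ, ENNReal.ofReal (v ^ (-b)) * truncSq a ∂ν :=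
        setLIntegral_mono_ae' measurableSet_Ici.compl hsmall
    _ ≤ ∫⁻ v, ENNReal.ofReal (v ^ (-b)) * truncSq a ∂ν := setLIntegral_le_lintegral _ _
    _ = (∫⁻ z, ENNReal.ofReal (z ^ (-(θ * b))) ∂κ) * truncSq a := by
        rw [lintegral_mul_const _ (by fun_prop), lintegral_map (by fun_prop) hθm]
        congr 1
        refine lintegral_congr_ae ?_
        filter_upwards [hκ.pos] with z hz
        rw [← Real.rpow_mul hz.le, mul_neg]

theorem lintegral_piMeasure {f : ℝ → ℝ} {α p : ℝ} (hp : 0 < p) (hf : Measurable f)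
    (hf0 : ∀ x, 0 ≤ f x) {φ : ℝ → ENNReal} (hφ : Measurable φ) :
    ∫⁻ s, φ s ∂(piMeasure f α p)
      = ∫⁻ x, ENNReal.ofReal (x ^ (α / p)) * φ (x ^ (-(1 / p))) ∂(stableLaw f) := by
  have himage : (fun s : ℝ => s ^ (-p)) '' Ioi 0 = Ioi 0 := by
    ext x
    constructor
    · rintro ⟨s, hs, rfl⟩
      exact Real.rpow_pos_of_pos hs _
    · intro hx
      refine ⟨x ^ (-(1 / p)), Real.rpow_pos_of_pos hx _, ?_⟩
      have : -(1 / p) * -p = 1 := by field_simp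
      simp only
      rw [← Real.rpow_mul (le_of_lt hx), this, Real.rpow_one]
  have hinj : InjOn (fun s : ℝ => s ^ (-p)) (Ioi 0) := fun x hx y hy hxy =>
    (Real.rpow_left_inj (le_of_lt hx) (le_of_lt hy) (neg_ne_zero.2 hp.ne')).1 hxy
  have hderiv : ∀ s ∈ Ioi (0 : ℝ),
      HasDerivWithinAt (fun s : ℝ => s ^ (-p)) (-p * s ^ (-p - 1)) (Ioi 0) s := fun s hs =>
    (Real.hasDerivAt_rpow_const (Or.inl (ne_of_gt hs))).hasDerivWithinAt
  rw [stableLaw, lintegral_withDensity_eq_lintegral_mul _ (by fun_prop) (by fun_prop)]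
  conv_rhs => rw [← himage]
  rw [lintegral_image_eq_lintegral_abs_deriv_mul measurableSet_Ioi hderiv hinj, piMeasure,
    lintegral_withDensity_eq_lintegral_mul _ _ hφ, ← lintegral_indicator measurableSet_Ioi]
  · refine lintegral_congr fun s => ?_
    by_cases hs : 0 < s
    · have e1 : (s ^ (-p)) ^ (-(1 / p)) = s := by
        have : -p * -(1 / p) = 1 := by field_simp
        rw [← Real.rpow_mul hs.le, this, Real.rpow_one]
      have e2 : (s ^ (-p)) ^ (α / p) = s ^ (-α) := by
        rw [← Real.rpow_mul hs.le]
        congr 1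
        field_simp
      have e3 : s ^ (-α - p - 1) = s ^ (-p - 1) * s ^ (-α) := by
        rw [← Real.rpow_add hs]
        ring_nf
      have e4 : |-p * s ^ (-p - 1)| = p * s ^ (-p - 1) := by
        rw [abs_mul, abs_neg, abs_of_pos hp, abs_of_pos (Real.rpow_pos_of_pos hs _)]
      rw [indicator_of_mem (show s ∈ Ioi 0 from hs)]
      simp only [Pi.mul_apply, if_pos hs]
      have hf' := hf0 (s ^ (-p))
      rw [e1, e2, e3, e4, ← mul_assoc, ← mul_assoc, ← mul_assoc, ← ENNReal.ofReal_mul (by positivity),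
        ← ENNReal.ofReal_mul (by positivity)]
      congr 2
      ring
    · rw [indicator_of_notMem (show s ∉ Ioi 0 from hs)]
      simp [hs]
  · exact Measurable.ite measurableSet_Ioi (by fun_prop) measurable_const

instance (f : ℝ → ℝ) (α p : ℝ) : SFinite (piMeasure f α p) := by
  have : SigmaFinite (piMeasure f α p) :=
    SigmaFinite.withDensity_of_ne_top' fun s => by split_ifs <;> simp
  infer_instance

theorem piMeasure_singleton_zero (f : ℝ → ℝ) (α p : ℝ) : piMeasure f α p {0} = 0 :=
  withDensity_absolutelyContinuous _ _ (measure_singleton 0)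

theorem ae_piMeasure_pos (f : ℝ → ℝ) (hf : Measurable f) (α p : ℝ) :
    ∀ᵐ s ∂(piMeasure f α p), 0 < s := by
  rw [piMeasure, ae_withDensity_iff
    (Measurable.ite measurableSet_Ioi (by fun_prop) measurable_const)]
  refine ae_of_all _ fun s hs => ?_
  by_contra hc
  simp [hc] at hs

section Upsilon

variable [SecondCountableTopology E]

theorem lintegral_upsilon {ρ : Measure ℝ} [SFinite ρ] {M : Measure E} [SFinite M]
    {φ : E → ENNReal} (hφ : Measurable φ) :
    ∫⁻ y, φ y ∂(Upsilon ρ M) = ∫⁻ x, ∫⁻ s, φ (s • x) ∂ρ ∂M := by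
  have hm : Measurable fun sx : ℝ × E => sx.1 • sx.2 := by fun_prop
  rw [Upsilon, lintegral_map hφ hm, lintegral_prod_symm _ (by fun_prop)]

theorem upsilon_singleton_zero {ρ : Measure ℝ} [SFinite ρ] {M : Measure E} [SFinite M]
    (hρ : ρ {0} = 0) (hM : M {0} = 0) : Upsilon ρ M {0} = 0 := by
  have hm : Measurable fun sx : ℝ × E => sx.1 • sx.2 := by fun_prop
  have h : (fun sx : ℝ × E => sx.1 • sx.2) ⁻¹' {0} ⊆ {0} ×ˢ univ ∪ univ ×ˢ {0} := by
    rintro ⟨s, x⟩ h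
    simpa [smul_eq_zero] using h
  rw [Upsilon, Measure.map_apply hm (measurableSet_singleton 0)]
  refine measure_mono_null h (measure_union_null ?_ ?_) <;> simp [Measure.prod_prod, hρ, hM]

end Upsilon

theorem isLevyMeasure_of_lintegral_lt_top {F : Type*} [NormedAddCommGroup F]
    [MeasurableSpace F] [BorelSpace F] {M : Measure F} (h0 : M {0} = 0)
    (hM : ∫⁻ x, truncSq ‖x‖ ∂M < ⊤) : IsLevyMeasure M := by
  refine ⟨⟨⟨⟨fun n => {x | ((n : ENNReal) + 1)⁻¹ ≤ truncSq ‖x‖} ∪ {0}, fun _ => trivial,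
    fun n => ?_, ?_⟩⟩⟩, h0, hM⟩
  · refine (measure_union_le _ _).trans_lt ?_
    rw [h0, add_zero]
    exact (meas_ge_le_lintegral_div (by fun_prop) (by simp) (by simp)).trans_lt
      (ENNReal.div_lt_top hM.ne (by simp))
  · refine eq_univ_of_forall fun x => mem_iUnion.2 ?_
    by_cases hx : x = 0
    · exact ⟨0, Or.inr hx⟩
    · have : truncSq ‖x‖ ≠ 0 := by
        unfold truncSq
        have : 0 < ‖x‖ := norm_pos_iff.2 hx
        simp [hx]
      obtain ⟨n, hn⟩ := ENNReal.exists_inv_nat_lt this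
      exact ⟨n, Or.inl ((ENNReal.inv_le_inv.2 le_self_add).trans hn.le)⟩

/-- Composing the transforms with dilation measures `π_{α,p→q}` and `π_{α,q→r}` amounts to
integrating against the stable law of the product. -/
theorem lintegral_piMeasure_comp {fqr fpq : ℝ → ℝ} {α q p : ℝ} (hq : 0 < q) (hqp : q < p)
    (hm₁ : Measurable fqr) (h₁ : ∀ x, 0 ≤ fqr x) (hm₂ : Measurable fpq) (h₂ : ∀ x, 0 ≤ fpq x)
    (hpos₁ : ∀ᵐ y ∂(stableLaw fqr), 0 < y) (hpos₂ : ∀ᵐ x ∂(stableLaw fpq), 0 < x)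
    [SFinite (stableLaw fqr)] [SFinite (stableLaw fpq)] (a : ℝ) :
    ∫⁻ t, ∫⁻ s, truncSq (s * t * a) ∂(piMeasure fpq α p) ∂(piMeasure fqr α q)
      = ∫⁻ z, weightedTruncSq (α / q) (1 / q) a (z ^ (q / p))
          ∂(((stableLaw fpq).prod (stableLaw fqr)).map fun z => z.1 * z.2 ^ (1 / (q / p))) := by
  have hp : 0 < p := hq.trans hqp
  have hm : Measurable fun z : ℝ × ℝ => z.1 * z.2 ^ (1 / (q / p)) := by fun_prop
  have hin : Measurable fun t => ∫⁻ s, truncSq (s * t * a) ∂(piMeasure fpq α p) :=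
    Measurable.lintegral_prod_left' (f := fun z : ℝ × ℝ => truncSq (z.1 * z.2 * a)) (by fun_prop)
  rw [lintegral_piMeasure hq hm₁ h₁ hin, lintegral_map (by fun_prop) hm,
    lintegral_prod_symm _ (by fun_prop)]
  refine lintegral_congr_ae ?_
  filter_upwards [hpos₁] with y hy
  rw [lintegral_piMeasure hp hm₂ h₂ (by fun_prop), ← lintegral_const_mul _ (by fun_prop)]
  refine lintegral_congr_ae ?_
  filter_upwards [hpos₂] with x hx
  have e : (x * y ^ (1 / (q / p))) ^ (q / p) = x ^ (q / p) * y := by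
    rw [Real.mul_rpow hx.le (by positivity), ← Real.rpow_mul hy.le,
      one_div_mul_cancel (by positivity), Real.rpow_one]
  have e1 : (x ^ (q / p) * y) ^ (α / q) = y ^ (α / q) * x ^ (α / p) := by
    rw [Real.mul_rpow (by positivity) hy.le, ← Real.rpow_mul hx.le, mul_comm]
    congr 2
    field_simp
  have e2 : (x ^ (q / p) * y) ^ (-(1 / q)) = x ^ (-(1 / p)) * y ^ (-(1 / q)) := by
    rw [Real.mul_rpow (by positivity) hy.le, ← Real.rpow_mul hx.le]
    congr 2
    field_simp
  rw [e, weightedTruncSq, e1, e2, ENNReal.ofReal_mul (by positivity), mul_comm a, mul_assoc,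
    mul_assoc (ENNReal.ofReal _)]

theorem stmt6 (d : ℕ) (hd : 1 ≤ d) (α r q p : ℝ) (hr : 0 < r) (hrq : r < q) (hqp : q < p)
    (fqr : ℝ → ℝ) (hfqr : IsStableDensity (r / q) fqr)
    (fpq : ℝ → ℝ) (hfpq : IsStableDensity (q / p) fpq) :
    UpsilonRange (E := EuclideanSpace ℝ (Fin d)) (piMeasure fqr α q) ⊆
      UpsilonDomain (piMeasure fpq α p) := by
  have hq : 0 < q := hr.trans hrq
  have hp : 0 < p := hq.trans hqp
  have hμ := hfqr.isStableLaw (by positivity)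
  have hν := hfpq.isStableLaw (by positivity)
  have := hμ.prob
  have := hν.prob
  have hκ := hν.map_prod hμ (by positivity)
  obtain ⟨A, B, hA, hB, hAB⟩ := hμ.exists_lintegral_weightedTruncSq_le (γ := α / q) (δ := 1 / q)
    hκ (by positivity) ((div_lt_one hq).2 hrq) (by positivity) (by positivity)
  rintro _ ⟨M, ⟨hM, hN⟩, rfl⟩
  refine ⟨hN, isLevyMeasure_of_lintegral_lt_top ?_ ?_⟩
  · have := hN.1
    exact upsilon_singleton_zero (piMeasure_singleton_zero _ _ _) hN.2.1
  have := hM.1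
  have := hN.1
  have hin : Measurable fun y : EuclideanSpace ℝ (Fin d) =>
      ∫⁻ s, truncSq ‖s • y‖ ∂(piMeasure fpq α p) :=
    Measurable.lintegral_prod_left'
      (f := fun z : ℝ × EuclideanSpace ℝ (Fin d) => truncSq ‖z.1 • z.2‖) (by fun_prop)
  have hNfin : ∫⁻ x, ∫⁻ t, truncSq ‖t • x‖ ∂(piMeasure fqr α q) ∂M < ⊤ := by
    rw [← lintegral_upsilon (φ := fun y => truncSq ‖y‖) (by fun_prop)]
    exact hN.2.2
  have hMfin : ∫⁻ x, truncSq ‖x‖ ∂M < ⊤ := hM.2.2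
  rw [lintegral_upsilon (by fun_prop), lintegral_upsilon hin]
  have hpt : ∀ x : EuclideanSpace ℝ (Fin d),
      ∫⁻ t, ∫⁻ s, truncSq ‖s • t • x‖ ∂(piMeasure fpq α p) ∂(piMeasure fqr α q)
        ≤ A * ∫⁻ t, truncSq ‖t • x‖ ∂(piMeasure fqr α q) + B * truncSq ‖x‖ := by
    intro x
    have e1 : ∫⁻ t, ∫⁻ s, truncSq ‖s • t • x‖ ∂(piMeasure fpq α p) ∂(piMeasure fqr α q)
        = ∫⁻ t, ∫⁻ s, truncSq (s * t * ‖x‖) ∂(piMeasure fpq α p) ∂(piMeasure fqr α q) := by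
      refine lintegral_congr fun t => lintegral_congr fun s => ?_
      simp only [truncSq, norm_smul, mul_pow, Real.norm_eq_abs, sq_abs, mul_assoc]
    have e2 : ∫⁻ t, truncSq ‖t • x‖ ∂(piMeasure fqr α q)
        = ∫⁻ y, weightedTruncSq (α / q) (1 / q) ‖x‖ y ∂(stableLaw fqr) := by
      rw [← lintegral_congr (f := fun t => truncSq (t * ‖x‖)),
        lintegral_piMeasure hq hfqr.1 hfqr.2.1 (by fun_prop)]
      · simp only [weightedTruncSq, mul_comm ‖x‖]
      · intro t
        simp only [truncSq, norm_smul, mul_pow, Real.norm_eq_abs, sq_abs]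
    rw [e1, e2, lintegral_piMeasure_comp hq hqp hfqr.1 hfqr.2.1 hfpq.1 hfpq.2.1 hμ.pos hν.pos]
    exact hAB _ (norm_nonneg x)
  calc _ ≤ ∫⁻ x, (A * ∫⁻ t, truncSq ‖t • x‖ ∂(piMeasure fqr α q) + B * truncSq ‖x‖) ∂M :=
        lintegral_mono hpt
    _ = A * ∫⁻ x, ∫⁻ t, truncSq ‖t • x‖ ∂(piMeasure fqr α q) ∂M
        + B * ∫⁻ x, truncSq ‖x‖ ∂M := by
        rw [lintegral_add_right _ (by fun_prop), lintegral_const_mul' _ _ hA,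
          lintegral_const_mul' _ _ hB]
    _ < ⊤ := ENNReal.add_lt_top.2
        ⟨ENNReal.mul_lt_top hA.lt_top hNfin, ENNReal.mul_lt_top hB.lt_top hMfin⟩
end
end
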